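/- Let A = ℂ[x_1, x_2, x_3, x_4], f = x_1·x_2·(x_1 + x_2)·(x_1 + x_2·x_3)·(x_1 + x_2·x_4), and g_j = ∂f/∂x_j for j = 1, 2, 3, 4. Then s·p ∈ ker^{(1)}φ for every p ∈ ker φ, while ker φ ≠ ker^{(1)}φ. In other words, the 'five lines' divisor satisfies property (GCL) with N = 1 but is not of commutative linear type. -/

import Mathlib

open MvPolynomial

set_option synthInstance.maxHeartbeats 1000000
set_option maxHeartbeats 1000000

/-- The `A`-algebra map `φ : A[s, ξ_1, …, ξ_n] → A[t]` with `φ(s) = f·t` and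
`φ(ξ_j) = g_j·t`; variable `0` is `s` and variable `j.succ` is `ξ_j`. Its image is the
Rees algebra of the ideal `(f, g_1, …, g_n)`. -/
noncomputable def reesPhi {A : Type*} [CommRing A] {n : ℕ} (f : A) (g : Fin n → A) :
    MvPolynomial (Fin (n + 1)) A →ₐ[A] Polynomial A :=
  aeval (Fin.cons (Polynomial.C f * Polynomial.X) fun j => Polynomial.C (g j) * Polynomial.X)

/-- `ker^{(1)} φ`: the ideal of `A[s, ξ_1, …, ξ_n]` generated by the homogeneous
elements of degree `1` lying in `ker φ`. -/
noncomputable def kerOne {A : Type*} [CommRing A] {n : ℕ} (f : A) (g : Fin n → A) :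
    Ideal (MvPolynomial (Fin (n + 1)) A) :=
  Ideal.span {p | p ∈ RingHom.ker (reesPhi f g) ∧ p.IsHomogeneous 1}

/-- The equation of the "five lines" divisor in `ℂ^4`:
`f = x_1·x_2·(x_1 + x_2)·(x_1 + x_2·x_3)·(x_1 + x_2·x_4)`. -/
noncomputable def fiveLines : MvPolynomial (Fin 4) ℂ :=
  X 0 * X 1 * (X 0 + X 1) * (X 0 + X 1 * X 2) * (X 0 + X 1 * X 3)

namespace FiveLines

theorem sub_bind₁_mem {σ R : Type*} [CommRing R] {I : Ideal (MvPolynomial σ R)}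
    {g : σ → MvPolynomial σ R} (h : ∀ i, X i - g i ∈ I) (p : MvPolynomial σ R) :
    p - bind₁ g p ∈ I := by
  rw [← Ideal.Quotient.eq]
  have : Ideal.Quotient.mkₐ R I = (Ideal.Quotient.mkₐ R I).comp (bind₁ g) := by
    ext i
    simpa using Ideal.Quotient.eq.2 (h i)
  exact DFunLike.congr_fun this p

theorem dvd_sub_bind₁ {σ R : Type*} [CommRing R] {a : MvPolynomial σ R}
    {g : σ → MvPolynomial σ R} (h : ∀ i, a ∣ X i - g i) (p : MvPolynomial σ R) :
    a ∣ p - bind₁ g p := by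
  exact Ideal.mem_span_singleton.1
    (sub_bind₁_mem (fun i => Ideal.mem_span_singleton.2 (h i)) p)

theorem dvd_of_bind₁_eq_zero {σ R : Type*} [CommRing R] {a : MvPolynomial σ R}
    {g : σ → MvPolynomial σ R} (h : ∀ i, a ∣ X i - g i) {p : MvPolynomial σ R}
    (hp : bind₁ g p = 0) : a ∣ p := by
  simpa [hp] using dvd_sub_bind₁ h p

section Minors

variable {R : Type*} [CommRing R] (k : R) (v : Fin 8 → R)

/-- The element `s` expressed through the Euler relation `5 s = x a + y b`, where `k = 1/5` and
`v` lists `x, y, z, w` and `a, b, c, d` (standing for `ξ_1, …, ξ_4`). -/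
def euler : R := k * (v 0 * v 4 + v 1 * v 5)

/-- The element `e`, whose value under `φ` is `y f / x` times `t`. -/
def polar : R :=
  (v 0 + v 1) * v 4 - 4 * euler k v - (1 - v 2) * v 6 - (1 - v 3) * v 7

/-- The `2 × 2` minors of the matrix with rows `(x, s, s - z c, s - w d)` and `(y, e, c, d)`. -/
def minor : Fin 6 → R :=
  ![v 0 * polar k v - v 1 * euler k v,
    v 0 * v 6 - v 1 * (euler k v - v 2 * v 6),
    v 0 * v 7 - v 1 * (euler k v - v 3 * v 7),
    euler k v * v 6 - polar k v * (euler k v - v 2 * v 6),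
    euler k v * v 7 - polar k v * (euler k v - v 3 * v 7),
    (euler k v - v 2 * v 6) * v 7 - v 6 * (euler k v - v 3 * v 7)]

theorem map_minor {S : Type*} [CommRing S] (F : R →+* S) (i : Fin 6) :
    F (minor k v i) = minor (F k) (fun j => F (v j)) i := by
  fin_cases i <;> simp [minor, polar, euler, map_ofNat]

end Minors

/-- The polynomial ring in `x, y, z, w, a, b, c, d`. -/
abbrev T := MvPolynomial (Fin 8) ℂ

/-- The ideal of `2 × 2` minors. -/
noncomputable def J : Ideal T := Ideal.span (Set.range (minor (C 5⁻¹ : T) X))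

local notation "m" => minor (C 5⁻¹ : T) X

local notation "setY" => (bind₁ ![X 0, 0, X 2, X 3, X 4, X 5, X 6, X 7] : T →ₐ[ℂ] T)
local notation "setXY" => (bind₁ ![0, 0, X 2, X 3, X 4, X 5, X 6, X 7] : T →ₐ[ℂ] T)
local notation "setC" => (bind₁ ![X 0, X 1, X 2, X 3, X 4, X 5, 0, X 7] : T →ₐ[ℂ] T)
local notation "setD" => (bind₁ ![X 0, X 1, X 2, X 3, X 4, X 5, X 6, 0] : T →ₐ[ℂ] T)
local notation "setYCD" => (bind₁ ![X 0, 0, X 2, X 3, X 4, X 5, 0, 0] : T →ₐ[ℂ] T)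
local notation "setWZ" => (bind₁ ![X 0, X 1, X 2, X 2, X 4, X 5, X 6, X 7] : T →ₐ[ℂ] T)

theorem five_mul : (5 : T) * C 5⁻¹ = 1 := by
  rw [show (5 : T) = C 5 from (map_ofNat C 5).symm, ← C_mul]; simp

theorem C_five_inv_ne : (C 5⁻¹ : T) ≠ 0 := fun h => by simpa [h] using five_mul

theorem minor_mem (i : Fin 6) : m i ∈ J := Ideal.subset_span ⟨i, rfl⟩

theorem X_ne (i : Fin 8) : (X i : T) ≠ 0 := X_ne_zero i

theorem one_sub_X_ne (i : Fin 8) : (1 - X i : T) ≠ 0 := fun h => by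
  simpa using congrArg (aeval (fun _ => (0 : ℂ))) h

theorem koszul_lift {Q₁ Q₂ : T} (h : X 1 ∣ Q₁ * m 1 + Q₂ * m 2) :
    ∃ j ∈ J, Q₁ * m 1 + Q₂ * m 2 = X 1 * j := by
  have hsetY : ∀ p, X 1 ∣ p - setY p := dvd_sub_bind₁ (fun i => by fin_cases i <;> simp)
  obtain ⟨P, hP⟩ := h
  have h0 := congrArg setY hP
  simp [minor, euler, polar] at h0
  have h1 : X 6 * setY Q₁ + X 7 * setY Q₂ = 0 := by
    apply mul_left_cancel₀ (X_ne 0)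
    linear_combination h0
  have h2 := congrArg setD h1
  simp [-mul_eq_zero] at h2
  obtain ⟨U, hU⟩ : X 7 ∣ setY Q₁ :=
    dvd_of_bind₁_eq_zero (g := ![X 0, X 1, X 2, X 3, X 4, X 5, X 6, 0])
      (fun i => by fin_cases i <;> simp) h2
  have h3 : setY Q₂ = - (X 6 * U) := by
    apply mul_left_cancel₀ (X_ne 7)
    linear_combination h1 - X 6 * hU
  obtain ⟨A, hA⟩ := hsetY Q₁
  obtain ⟨B, hB⟩ := hsetY Q₂
  refine ⟨-U * m 5 + A * m 1 + B * m 2, ?_, ?_⟩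
  · exact J.add_mem (J.add_mem (J.mul_mem_left _ (minor_mem 5)) (J.mul_mem_left _ (minor_mem 1)))
      (J.mul_mem_left _ (minor_mem 2))
  · simp only [minor, Matrix.cons_val]
    linear_combination (X 0 * X 6 - X 1 * (euler (C 5⁻¹) X - X 2 * X 6)) * (hA + hU) +
      (X 0 * X 7 - X 1 * (euler (C 5⁻¹) X - X 3 * X 7)) * (hB + h3)

theorem three_minors_lift {Q₀ Q₁ Q₂ : T} (h : X 1 ∣ Q₀ * m 0 + Q₁ * m 1 + Q₂ * m 2) :
    ∃ j ∈ J, Q₀ * m 0 + Q₁ * m 1 + Q₂ * m 2 = X 1 * j := by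
  have hmem := sub_bind₁_mem (R := ℂ) (I := Ideal.span {X 6, X 7, X 1})
    (g := ![X 0, 0, X 2, X 3, X 4, X 5, 0, 0])
    (fun i => by fin_cases i <;> simp <;> exact Ideal.subset_span (by simp)) Q₀
  have h0 : setYCD Q₀ = 0 := by
    obtain ⟨P, hP⟩ := h
    have h0 := congrArg setYCD hP
    simp [minor, euler, polar, map_ofNat, -mul_eq_zero] at h0
    have h1 : (C 5⁻¹ * X 0 * X 0 * X 4) * setYCD Q₀ = 0 := by
      linear_combination h0 + setYCD Q₀ * X 0 * X 0 * X 4 * five_mul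
    simpa [X_ne, C_five_inv_ne] using h1
  rw [h0, sub_zero, Ideal.mem_span_insert'] at hmem
  obtain ⟨P, hP⟩ := hmem
  obtain ⟨P₂, P₃, hQ⟩ := Ideal.mem_span_pair.1 hP
  obtain ⟨P₁, rfl⟩ : ∃ P₁, P = -P₁ := ⟨-P, by simp⟩
  have key : Q₀ * m 0 + Q₁ * m 1 + Q₂ * m 2 =
      ((Q₁ + P₁ * polar (C 5⁻¹) X) * m 1 + (Q₂ + P₂ * polar (C 5⁻¹) X) * m 2) +
        X 1 * (P₃ * m 0 - P₁ * m 3 - P₂ * m 4) := by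
    simp only [minor, Matrix.cons_val]
    linear_combination (-(X 0 * polar (C 5⁻¹) X - X 1 * euler (C 5⁻¹) X)) * hQ
  rw [key] at h ⊢
  obtain ⟨j, hj, hj'⟩ := koszul_lift ((dvd_add_left (dvd_mul_right _ _)).1 h)
  refine ⟨j + (P₃ * m 0 - P₁ * m 3 - P₂ * m 4), ?_, by rw [hj']; ring⟩
  exact J.add_mem hj (J.sub_mem (J.sub_mem (J.mul_mem_left _ (minor_mem 0))
    (J.mul_mem_left _ (minor_mem 3))) (J.mul_mem_left _ (minor_mem 4)))

/-- The syzygies of the three minors `z c g`, `w d g`, `(w - z) c d`, with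
`g = (1 - z) c + (1 - w) d`. -/
theorem syzygy_of_x_y_zero {q₃ q₄ q₅ : T}
    (h : -(X 2 * X 6 * ((1 - X 2) * X 6 + (1 - X 3) * X 7)) * q₃ -
      X 3 * X 7 * ((1 - X 2) * X 6 + (1 - X 3) * X 7) * q₄ +
        (X 3 - X 2) * X 6 * X 7 * q₅ = 0) :
    ∃ r t : T, q₃ = X 7 * r ∧ q₄ = X 6 * (-r + (X 3 - X 2) * t) ∧
      q₅ = ((1 - X 2) * X 6 + (1 - X 3) * X 7) * (-r + X 3 * t) := by
  have hwz : (X 3 - X 2 : T) ≠ 0 := fun h0 => by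
    simpa using congrArg (aeval (fun i : Fin 8 => if i = 3 then (1 : ℂ) else 0)) h0
  have hcd : (X 6 + X 7 : T) ≠ 0 := fun h0 => by
    simpa using congrArg (aeval (fun i : Fin 8 => if i = 6 then (1 : ℂ) else 0)) h0
  obtain ⟨r₄, rfl⟩ : X 6 ∣ q₄ := by
    refine dvd_of_bind₁_eq_zero (g := ![X 0, X 1, X 2, X 3, X 4, X 5, 0, X 7])
      (fun i => by fin_cases i <;> simp) ?_
    have h0 := congrArg setC h
    simpa [X_ne, one_sub_X_ne] using h0
  obtain ⟨r₃, rfl⟩ : X 7 ∣ q₃ := by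
    refine dvd_of_bind₁_eq_zero (g := ![X 0, X 1, X 2, X 3, X 4, X 5, X 6, 0])
      (fun i => by fin_cases i <;> simp) ?_
    have h0 := congrArg setD h
    simpa [X_ne, one_sub_X_ne] using h0
  have h1 : -((1 - X 2) * X 6 + (1 - X 3) * X 7) * (X 2 * r₃ + X 3 * r₄) +
      (X 3 - X 2) * q₅ = 0 := by
    apply mul_left_cancel₀ (mul_ne_zero (X_ne 6) (X_ne 7))
    linear_combination h
  obtain ⟨t, ht⟩ : X 3 - X 2 ∣ r₃ + r₄ := by
    refine dvd_of_bind₁_eq_zero (g := ![X 0, X 1, X 2, X 2, X 4, X 5, X 6, X 7])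
      (fun i => by fin_cases i <;> simp) ?_
    have h0 := congrArg setWZ h1
    simp [-mul_eq_zero] at h0
    rw [map_add]
    apply mul_left_cancel₀ (mul_ne_zero (X_ne 2) (mul_ne_zero (one_sub_X_ne 2) hcd))
    rw [mul_zero]
    linear_combination -h0
  obtain rfl : r₄ = -r₃ + (X 3 - X 2) * t := by linear_combination ht
  refine ⟨r₃, t, rfl, rfl, ?_⟩
  apply mul_left_cancel₀ hwz
  linear_combination h1

theorem six_minors_lift {Q : Fin 6 → T} (h : X 1 ∣ ∑ i, Q i * m i) :
    ∃ j ∈ J, ∑ i, Q i * m i = X 1 * j := by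
  have hmem : ∀ p : T, ∃ A B, p = setXY p +
      X 0 * A + X 1 * B := fun p => by
    have := sub_bind₁_mem (R := ℂ) (I := Ideal.span {X 0, X 1})
      (g := ![0, 0, X 2, X 3, X 4, X 5, X 6, X 7])
      (fun i => by fin_cases i <;> simp <;> exact Ideal.subset_span (by simp)) p
    obtain ⟨A, B, hAB⟩ := Ideal.mem_span_pair.1 this
    exact ⟨A, B, by linear_combination -hAB⟩
  obtain ⟨r, t, h₃, h₄, h₅⟩ := by
    refine syzygy_of_x_y_zero (q₃ := setXY (Q 3))
      (q₄ := setXY (Q 4))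
      (q₅ := setXY (Q 5)) ?_
    obtain ⟨P, hP⟩ := h
    have h0 := congrArg setXY hP
    simp [minor, euler, polar, Fin.sum_univ_six] at h0
    linear_combination h0
  obtain ⟨A₃, B₃, e₃⟩ := hmem (Q 3)
  obtain ⟨A₄, B₄, e₄⟩ := hmem (Q 4)
  obtain ⟨A₅, B₅, e₅⟩ := hmem (Q 5)
  rw [h₃] at e₃
  rw [h₄] at e₄
  rw [h₅] at e₅
  obtain ⟨A₃', hA₃⟩ : ∃ A, A = A₃ + t * C 5⁻¹ * X 4 := ⟨_, rfl⟩
  obtain ⟨A₄', hA₄⟩ : ∃ A, A = A₄ - t * C 5⁻¹ * X 4 := ⟨_, rfl⟩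
  obtain ⟨A₅', hA₅⟩ : ∃ A, A = A₅ - (r - X 3 * t) * (X 4 - 4 * C 5⁻¹ * X 4) + t * C 5⁻¹ * X 4 :=
    ⟨_, rfl⟩
  obtain ⟨B₃', hB₃⟩ : ∃ A, A = B₃ + t * C 5⁻¹ * X 5 := ⟨_, rfl⟩
  obtain ⟨B₄', hB₄⟩ : ∃ A, A = B₄ - t * C 5⁻¹ * X 5 := ⟨_, rfl⟩
  obtain ⟨B₅', hB₅⟩ : ∃ A, A = B₅ - (r - X 3 * t) * (X 4 - 4 * C 5⁻¹ * X 5) + t * C 5⁻¹ * X 5 :=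
    ⟨_, rfl⟩
  obtain ⟨s, hs⟩ : ∃ s, s = euler (C 5⁻¹ : T) X := ⟨_, rfl⟩
  obtain ⟨e, he⟩ : ∃ e, e = polar (C 5⁻¹ : T) X := ⟨_, rfl⟩
  have f₃ : Q 3 = (r - X 3 * t) * X 7 - t * (s - X 3 * X 7) + X 0 * A₃' + X 1 * B₃' := by
    rw [e₃, hA₃, hB₃, hs, euler]; ring
  have f₄ : Q 4 = -((r - X 3 * t) * X 6) + t * (s - X 2 * X 6) + X 0 * A₄' + X 1 * B₄' := by
    rw [e₄, hA₄, hB₄, hs, euler]; ring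
  have f₅ : Q 5 = (r - X 3 * t) * e - t * s + X 0 * A₅' + X 1 * B₅' := by
    rw [e₅, hA₅, hB₅, he, polar, hs, euler]; ring
  have key : ∑ i, Q i * m i =
      ((Q 0 - (s - X 2 * X 6) * A₃' - (s - X 3 * X 7) * A₄') * m 0 +
        (Q 1 + s * A₃' - (s - X 3 * X 7) * A₅') * m 1 +
        (Q 2 + s * A₄' + (s - X 2 * X 6) * A₅') * m 2) +
        X 1 * (B₃' * m 3 + B₄' * m 4 + B₅' * m 5) := by
    rw [Fin.sum_univ_six, f₃, f₄, f₅]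
    simp only [minor, Matrix.cons_val, ← hs, ← he]
    ring
  rw [key] at h ⊢
  obtain ⟨j, hj, hj'⟩ := three_minors_lift ((dvd_add_left (dvd_mul_right _ _)).1 h)
  refine ⟨j + (B₃' * m 3 + B₄' * m 4 + B₅' * m 5), ?_, by rw [hj']; ring⟩
  exact J.add_mem hj (J.add_mem (J.add_mem (J.mul_mem_left _ (minor_mem 3))
    (J.mul_mem_left _ (minor_mem 4))) (J.mul_mem_left _ (minor_mem 5)))

/-- `y` is a nonzerodivisor modulo the ideal of minors. -/
theorem mem_J_of_y_mul_mem {p : T} (h : X 1 * p ∈ J) : p ∈ J := by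
  obtain ⟨Q, hQ⟩ := (Ideal.mem_span_range_iff_exists_fun).1 h
  obtain ⟨j, hj, hj'⟩ := six_minors_lift (Q := Q) ⟨p, hQ⟩
  rwa [mul_left_cancel₀ (X_ne 1) (hQ.symm.trans hj')]

theorem mem_J_of_y_pow_mul_mem {p : T} : ∀ {n : ℕ}, X 1 ^ n * p ∈ J → p ∈ J
  | 0, h => by simpa using h
  | n + 1, h => mem_J_of_y_pow_mul_mem (n := n)
      (mem_J_of_y_mul_mem (by rwa [← mul_assoc, ← pow_succ']))

/-- The coordinate ring, with variables `u, y, Z, W, c, d, τ`, of the affine space containing the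
chart `x = u y` of the variety of `J`. -/
abbrev P := MvPolynomial (Fin 7) ℂ

/-- The equations `Z c = W d = u (u + 1) τ` of the chart. -/
noncomputable def K : Ideal P :=
  Ideal.span {X 2 * X 4 - X 0 * (X 0 + 1) * X 6, X 3 * X 5 - X 0 * (X 0 + 1) * X 6}

theorem mem_K {p : P} : p ∈ K ↔ ∃ A B, A * (X 2 * X 4 - X 0 * (X 0 + 1) * X 6) +
    B * (X 3 * X 5 - X 0 * (X 0 + 1) * X 6) = p := Ideal.mem_span_pair

/-- Multiplication by `r` is injective modulo `K`. -/
def RegularModK (r : P) : Prop := ∀ q, r * q ∈ K → q ∈ K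

theorem RegularModK.mul {r s : P} (hr : RegularModK r) (hs : RegularModK s) :
    RegularModK (r * s) := fun q h => hs q (hr _ (by rwa [← mul_assoc]))

theorem RegularModK.pow {r : P} (hr : RegularModK r) : ∀ n : ℕ, RegularModK (r ^ n)
  | 0 => fun q h => by simpa using h
  | n + 1 => by rw [pow_succ]; exact (hr.pow n).mul hr

theorem P.X_ne (i : Fin 7) : (X i : P) ≠ 0 := X_ne_zero i

theorem P.X_add_one_ne (i : Fin 7) : (X i + 1 : P) ≠ 0 := fun h => by
  simpa using congrArg (aeval (fun _ => (0 : ℂ))) h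

theorem exists_of_mul_mem_K {r : P} {g : Fin 7 → P} (hg : ∀ i, r ∣ X i - g i)
    (h : ∀ A B : P, bind₁ g A * bind₁ g (X 2 * X 4 - X 0 * (X 0 + 1) * X 6) +
      bind₁ g B * bind₁ g (X 3 * X 5 - X 0 * (X 0 + 1) * X 6) = 0 →
      ∃ q ∈ K, bind₁ g A * (X 2 * X 4 - X 0 * (X 0 + 1) * X 6) +
        bind₁ g B * (X 3 * X 5 - X 0 * (X 0 + 1) * X 6) = r * q)
    (hr : bind₁ g r = 0) (hr0 : r ≠ 0) : RegularModK r := by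
  intro p hp
  obtain ⟨A, B, hAB⟩ := mem_K.1 hp
  have h0 := congrArg (bind₁ g) hAB
  rw [map_add, map_mul, map_mul, map_mul, hr, zero_mul] at h0
  obtain ⟨q, hq, hq'⟩ := h A B h0
  obtain ⟨A', hA⟩ := dvd_sub_bind₁ hg A
  obtain ⟨B', hB⟩ := dvd_sub_bind₁ hg B
  have : p = q + (A' * (X 2 * X 4 - X 0 * (X 0 + 1) * X 6) +
      B' * (X 3 * X 5 - X 0 * (X 0 + 1) * X 6)) := by
    apply mul_left_cancel₀ hr0
    linear_combination hq' - hAB + (X 2 * X 4 - X 0 * (X 0 + 1) * X 6) * hA +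
      (X 3 * X 5 - X 0 * (X 0 + 1) * X 6) * hB
  rw [this]
  exact K.add_mem hq (mem_K.2 ⟨A', B', rfl⟩)

theorem regular_y : RegularModK (X 1) := by
  refine exists_of_mul_mem_K (g := ![X 0, 0, X 2, X 3, X 4, X 5, X 6])
    (fun i => by fin_cases i <;> simp) (fun A B h => ⟨0, K.zero_mem, ?_⟩) (by simp) (P.X_ne 1)
  simpa using h

theorem eq_of_mul_add_mul_eq_zero {A B : P} (h : A * (X 2 * X 4) + B * (X 3 * X 5) = 0) :
    ∃ D, A = -(D * (X 3 * X 5)) ∧ B = D * (X 2 * X 4) := by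
  obtain ⟨B₁, rfl⟩ : X 2 ∣ B := by
    refine dvd_of_bind₁_eq_zero (g := ![X 0, X 1, 0, X 3, X 4, X 5, X 6])
      (fun i => by fin_cases i <;> simp) ?_
    simpa [P.X_ne] using congrArg (bind₁ (![X 0, X 1, 0, X 3, X 4, X 5, X 6] : Fin 7 → P)) h
  obtain ⟨B₂, rfl⟩ : X 4 ∣ B₁ := by
    refine dvd_of_bind₁_eq_zero (g := ![X 0, X 1, X 2, X 3, 0, X 5, X 6])
      (fun i => by fin_cases i <;> simp) ?_
    simpa [P.X_ne] using congrArg (bind₁ (![X 0, X 1, X 2, X 3, 0, X 5, X 6] : Fin 7 → P)) h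
  refine ⟨B₂, ?_, by ring⟩
  apply mul_right_cancel₀ (mul_ne_zero (P.X_ne 2) (P.X_ne 4))
  linear_combination h

theorem dvd_of_dvd_mul {B E F : P} (hF : F = X 3 * X 5 ∨ F = X 2 * X 4)
    (h : B * F = X 0 * (X 0 + 1) * X 6 * E) : X 0 * (X 0 + 1) * X 6 ∣ B := by
  obtain ⟨B₁, rfl⟩ : X 0 ∣ B := by
    refine dvd_of_bind₁_eq_zero (g := ![0, X 1, X 2, X 3, X 4, X 5, X 6])
      (fun i => by fin_cases i <;> simp) ?_
    have h0 := congrArg (bind₁ (![0, X 1, X 2, X 3, X 4, X 5, X 6] : Fin 7 → P)) h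
    rcases hF with rfl | rfl <;> simpa [P.X_ne] using h0
  obtain ⟨B₂, rfl⟩ : X 0 + 1 ∣ B₁ := by
    refine dvd_of_bind₁_eq_zero (g := ![-1, X 1, X 2, X 3, X 4, X 5, X 6])
      (fun i => by fin_cases i <;> simp) ?_
    have h0 := congrArg (bind₁ (![-1, X 1, X 2, X 3, X 4, X 5, X 6] : Fin 7 → P)) h
    rcases hF with rfl | rfl <;> simpa [P.X_ne] using h0
  obtain ⟨B₃, rfl⟩ : X 6 ∣ B₂ := by
    refine dvd_of_bind₁_eq_zero (g := ![X 0, X 1, X 2, X 3, X 4, X 5, 0])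
      (fun i => by fin_cases i <;> simp) ?_
    have h0 := congrArg (bind₁ (![X 0, X 1, X 2, X 3, X 4, X 5, 0] : Fin 7 → P)) h
    rcases hF with rfl | rfl <;> simpa [P.X_ne, P.X_add_one_ne] using h0
  exact ⟨B₃, by ring⟩

theorem regular_u : RegularModK (X 0) := by
  refine exists_of_mul_mem_K (g := ![0, X 1, X 2, X 3, X 4, X 5, X 6])
    (fun i => by fin_cases i <;> simp) (fun A B h => ?_) (by simp) (P.X_ne 0)
  obtain ⟨D, hA, hB⟩ := eq_of_mul_add_mul_eq_zero (by simpa using h)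
  refine ⟨_, mem_K.2 ⟨-(D * (X 0 + 1) * X 6), D * (X 0 + 1) * X 6, rfl⟩, ?_⟩
  rw [hA, hB]; ring

theorem regular_u_add_one : RegularModK (X 0 + 1) := by
  refine exists_of_mul_mem_K (g := ![-1, X 1, X 2, X 3, X 4, X 5, X 6])
    (fun i => by fin_cases i <;> simp) (fun A B h => ?_) (by simp) (P.X_add_one_ne 0)
  obtain ⟨D, hA, hB⟩ := eq_of_mul_add_mul_eq_zero (by simpa using h)
  refine ⟨_, mem_K.2 ⟨-(D * X 0 * X 6), D * X 0 * X 6, rfl⟩, ?_⟩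
  rw [hA, hB]; ring

theorem regular_Z : RegularModK (X 2) := by
  refine exists_of_mul_mem_K (g := ![X 0, X 1, 0, X 3, X 4, X 5, X 6])
    (fun i => by fin_cases i <;> simp) (fun A B h => ?_) (by simp) (P.X_ne 2)
  generalize bind₁ (![X 0, X 1, 0, X 3, X 4, X 5, X 6] : Fin 7 → P) A = A at h ⊢
  generalize bind₁ (![X 0, X 1, 0, X 3, X 4, X 5, X 6] : Fin 7 → P) B = B at h ⊢
  simp at h
  obtain ⟨D, rfl⟩ := dvd_of_dvd_mul (B := B) (E := A + B) (Or.inl rfl) (by linear_combination h)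
  have hA : A = D * (X 3 * X 5 - X 0 * (X 0 + 1) * X 6) := by
    apply mul_left_cancel₀ (mul_ne_zero (mul_ne_zero (P.X_ne 0) (P.X_add_one_ne 0)) (P.X_ne 6))
    linear_combination -h
  refine ⟨_, mem_K.2 ⟨0, D * X 4, rfl⟩, ?_⟩
  rw [hA]; ring

theorem regular_W : RegularModK (X 3) := by
  refine exists_of_mul_mem_K (g := ![X 0, X 1, X 2, 0, X 4, X 5, X 6])
    (fun i => by fin_cases i <;> simp) (fun A B h => ?_) (by simp) (P.X_ne 3)
  generalize bind₁ (![X 0, X 1, X 2, 0, X 4, X 5, X 6] : Fin 7 → P) A = A at h ⊢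
  generalize bind₁ (![X 0, X 1, X 2, 0, X 4, X 5, X 6] : Fin 7 → P) B = B at h ⊢
  simp at h
  obtain ⟨D, rfl⟩ := dvd_of_dvd_mul (B := A) (E := A + B) (Or.inr rfl) (by linear_combination h)
  have hB : B = D * (X 2 * X 4 - X 0 * (X 0 + 1) * X 6) := by
    apply mul_left_cancel₀ (mul_ne_zero (mul_ne_zero (P.X_ne 0) (P.X_add_one_ne 0)) (P.X_ne 6))
    linear_combination -h
  refine ⟨_, mem_K.2 ⟨D * X 5, 0, rfl⟩, ?_⟩
  rw [hB]; ring

/-- The substitution `x = u y`, `z = Z - u`, `w = W - u`, `a = c + d + (1 + 2 u) τ`,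
`b = 5 u (1 + u) τ - u a`, with `c` and `d` scaled by `y`. -/
noncomputable def chart : T →ₐ[ℂ] P :=
  aeval ![X 0 * X 1, X 1, X 2 - X 0, X 3 - X 0, X 4 + X 5 + (1 + 2 * X 0) * X 6,
    5 * X 0 * (X 0 + 1) * X 6 - X 0 * (X 4 + X 5 + (1 + 2 * X 0) * X 6), X 1 * X 4, X 1 * X 5]

theorem eq_zero_of_chart_mem {M : Type*} [CommRing M] (ι : T →+* M) {i : M}
    (hi : ι (X 1) * i = 1) (hJ : ∀ p ∈ J, ι p = 0) {p : T} (hp : chart p ∈ K) : ι p = 0 := by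
  obtain ⟨k, hk⟩ : ∃ k, k = ι (C 5⁻¹) := ⟨_, rfl⟩
  obtain ⟨v, hv⟩ : ∃ v : Fin 8 → M, v = fun j => ι (X j) := ⟨_, rfl⟩
  have hX : ∀ j, ι (X j) = v j := fun j => by rw [hv]
  have hmin : ∀ j, minor k v j = 0 := fun j => by
    rw [hk, hv, ← map_minor]; exact hJ _ (minor_mem j)
  have h5 : 5 * k = 1 := by
    rw [hk, ← map_ofNat ι 5, ← map_mul, five_mul, map_one]
  rw [hX] at hi
  have m₀ := hmin 0
  have m₁ := hmin 1
  have m₂ := hmin 2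
  simp only [minor, Matrix.cons_val] at m₀ m₁ m₂
  obtain ⟨e, he⟩ : ∃ e, e = polar k v := ⟨_, rfl⟩
  obtain ⟨s, hs⟩ : ∃ s, s = euler k v := ⟨_, rfl⟩
  rw [← hs] at m₀ m₁ m₂
  rw [← he] at m₀
  rw [polar, ← hs] at he
  have hs' : v 0 * v 4 + v 1 * v 5 = 5 * s := by
    rw [hs, euler]; linear_combination -(v 0 * v 4 + v 1 * v 5) * h5
  obtain ⟨t, ht⟩ : ∃ t, t = 2 * e - v 1 * v 4 + v 6 + v 7 := ⟨_, rfl⟩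
  have ha : v 6 * i + v 7 * i + (1 + 2 * (v 0 * i)) * (i * t) = v 4 := by
    rw [ht, he] at *
    linear_combination i ^ 2 * (4 * m₀ + 2 * m₁ + 2 * m₂) -
      (v 6 + v 7 + 2 * ((v 0 + v 1) * v 4 - 4 * s - (1 - v 2) * v 6 - (1 - v 3) * v 7) -
        v 1 * v 4 + v 6 + v 7) * i * hi + v 4 * (v 1 * i + 1) * hi
  have hst : (v 0 * i) * (v 0 * i + 1) * (i * t) = i * s := by
    rw [ht, he] at *
    linear_combination i ^ 3 * (v 1 * m₀ + v 0 * (2 * m₀ + m₁ + m₂)) -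
      v 0 * i ^ 2 * (2 * ((v 0 + v 1) * v 4 - 4 * s - (1 - v 2) * v 6 - (1 - v 3) * v 7) -
        v 1 * v 4 + v 6 + v 7) * hi + s * i * (v 1 * i + 1) * hi
  have hb : 5 * (v 0 * i) * (v 0 * i + 1) * (i * t) - (v 0 * i) * v 4 = v 5 := by
    linear_combination 5 * hst - i * hs' + v 5 * hi
  let ψ : P →+* M := eval₂Hom (ι.comp C)
    ![v 0 * i, v 1, v 2 + v 0 * i, v 3 + v 0 * i, v 6 * i, v 7 * i, i * t]
  have hψ : ψ.comp chart.toRingHom = ι := by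
    refine ringHom_ext (fun r => by simp [ψ, chart]) fun j => ?_
    rw [hX]
    fin_cases j
    · simp [ψ, chart]; linear_combination v 0 * hi
    · simp [ψ, chart]
    · simp [ψ, chart]
    · simp [ψ, chart]
    · simpa [ψ, chart, map_ofNat] using ha
    · simp only [← ha] at hb
      simpa [ψ, chart, map_ofNat] using hb
    · simp [ψ, chart]; linear_combination v 6 * hi
    · simp [ψ, chart]; linear_combination v 7 * hi
  obtain ⟨A, B, hAB⟩ := mem_K.1 hp
  have h₁ : ψ (X 2 * X 4 - X 0 * (X 0 + 1) * X 6) = 0 := by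
    simp [ψ]
    linear_combination i ^ 2 * m₁ - hst - (v 2 * v 6 - s) * i * hi
  have h₂ : ψ (X 3 * X 5 - X 0 * (X 0 + 1) * X 6) = 0 := by
    simp [ψ]
    linear_combination i ^ 2 * m₂ - hst - (v 3 * v 7 - s) * i * hi
  rw [← hψ]
  change ψ (chart p) = 0
  rw [← hAB, map_add, map_mul, map_mul, h₁, h₂, mul_zero, mul_zero, add_zero]

theorem exists_pow_mul_mem {R : Type*} [CommRing R] {I : Ideal R} {r p : R}
    (h : algebraMap (R ⧸ I) (Localization.Away (Ideal.Quotient.mk I r))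
      (Ideal.Quotient.mk I p) = 0) : ∃ n : ℕ, r ^ n * p ∈ I := by
  obtain ⟨⟨_, n, rfl⟩, hn⟩ := (IsLocalization.map_eq_zero_iff
    (Submonoid.powers (Ideal.Quotient.mk I r)) _ _).1 h
  exact ⟨n, by rw [← Ideal.Quotient.eq_zero_iff_mem]; simpa using hn⟩

theorem mem_J_of_chart_mem {p : T} (hp : chart p ∈ K) : p ∈ J := by
  let ι : T →+* Localization.Away (Ideal.Quotient.mk J (X 1)) :=
    (algebraMap (T ⧸ J) _).comp (Ideal.Quotient.mk J)
  have h : ι p = 0 := by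
    refine eq_zero_of_chart_mem ι (IsLocalization.Away.mul_invSelf (Ideal.Quotient.mk J (X 1)))
      (fun q hq => ?_) hp
    change algebraMap (T ⧸ J) _ (Ideal.Quotient.mk J q) = 0
    rw [Ideal.Quotient.eq_zero_iff_mem.2 hq, map_zero]
  obtain ⟨n, hn⟩ := exists_pow_mul_mem h
  exact mem_J_of_y_pow_mul_mem hn

/-- The polynomial ring in `x, y, z, w`. -/
abbrev A := MvPolynomial (Fin 4) ℂ

/-- The polynomial ring in `s, ξ_1, …, ξ_4` over `ℂ[x, y, z, w]`. -/
abbrev S := MvPolynomial (Fin 5) A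

theorem pderiv_zero : pderiv 0 fiveLines = (X 1 * (X 0 + X 1) * (X 0 + X 1 * X 2) *
    (X 0 + X 1 * X 3) + X 0 * X 1 * (X 0 + X 1 * X 2) * (X 0 + X 1 * X 3) +
    X 0 * X 1 * (X 0 + X 1) * (X 0 + X 1 * X 3) +
    X 0 * X 1 * (X 0 + X 1) * (X 0 + X 1 * X 2) : A) := by
  simp [fiveLines, pderiv_X]; ring

theorem pderiv_one : pderiv 1 fiveLines = (X 0 * (X 0 + X 1) * (X 0 + X 1 * X 2) *
    (X 0 + X 1 * X 3) + X 0 * X 1 * (X 0 + X 1 * X 2) * (X 0 + X 1 * X 3) +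
    X 0 * X 1 * (X 0 + X 1) * (X 0 + X 1 * X 3) * X 2 +
    X 0 * X 1 * (X 0 + X 1) * (X 0 + X 1 * X 2) * X 3 : A) := by
  simp [fiveLines, pderiv_X]; ring

theorem pderiv_two : pderiv 2 fiveLines =
    (X 0 * X 1 ^ 2 * (X 0 + X 1) * (X 0 + X 1 * X 3) : A) := by
  simp [fiveLines, pderiv_X]; ring

theorem pderiv_three : pderiv 3 fiveLines =
    (X 0 * X 1 ^ 2 * (X 0 + X 1) * (X 0 + X 1 * X 2) : A) := by
  simp [fiveLines, pderiv_X]; ring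

theorem eq_zero_of_mem_ker_reesPhi {B M : Type*} [CommRing B] [CommRing M] {n : ℕ} {f : B}
    {g : Fin n → B} (χ : MvPolynomial (Fin (n + 1)) B →+* M) {i : M} (hi : χ (C f) * i = 1)
    (h : ∀ j, χ (C f * X j.succ) = χ (C (g j) * X 0)) {p : MvPolynomial (Fin (n + 1)) B}
    (hp : p ∈ RingHom.ker (reesPhi f g)) : χ p = 0 := by
  have : χ = (Polynomial.eval₂RingHom (χ.comp C) (χ (X 0) * i)).comp (reesPhi f g).toRingHom := by
    refine ringHom_ext (fun r => by simp [reesPhi]) fun j => ?_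
    refine Fin.cases ?_ (fun j => ?_) j
    · simp [reesPhi]
      linear_combination -χ (X 0) * hi
    · have := h j
      simp at this
      simp [reesPhi]
      linear_combination -χ (X j.succ) * hi + i * this
  rw [this]
  change Polynomial.eval₂RingHom _ _ (reesPhi f g p) = 0
  rw [RingHom.mem_ker.1 hp, map_zero]

theorem linear_mem_ker {B : Type*} [CommRing B] {n : ℕ} {f : B} {g : Fin n → B}
    (α : Fin (n + 1) → B) : ∑ i, C (α i) * X i ∈ RingHom.ker (reesPhi f g) ↔
      α 0 * f + ∑ j, α j.succ * g j = 0 := by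
  have : reesPhi f g (∑ i, C (α i) * X i) =
      Polynomial.C (α 0 * f + ∑ j, α j.succ * g j) * Polynomial.X := by
    simp [reesPhi, Fin.sum_univ_succ, add_mul, Finset.sum_mul, mul_assoc, ← algebraMap_eq]
  rw [RingHom.mem_ker, this]
  constructor
  · intro h
    simpa using congrArg (Polynomial.coeff · 1) h
  · intro h
    rw [h]; simp

theorem linear_mem_kerOne {B : Type*} [CommRing B] {n : ℕ} {f : B} {g : Fin n → B}
    {α : Fin (n + 1) → B} (h : α 0 * f + ∑ j, α j.succ * g j = 0) :
    ∑ i, C (α i) * X i ∈ kerOne f g :=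
  Ideal.subset_span ⟨(linear_mem_ker α).2 h,
    IsHomogeneous.sum _ _ _ fun _ _ => isHomogeneous_C_mul_X _ _⟩

theorem map_kerOne_eq_zero {B M : Type*} [CommRing B] [CommRing M] {n : ℕ} {f : B} {g : Fin n → B}
    (χ : MvPolynomial (Fin (n + 1)) B →+* M)
    (h : ∀ α : Fin (n + 1) → B, α 0 * f + ∑ j, α j.succ * g j = 0 →
      χ (∑ i, C (α i) * X i) = 0) {p : MvPolynomial (Fin (n + 1)) B} (hp : p ∈ kerOne f g) :
    χ p = 0 := by
  refine (Ideal.span_le (I := RingHom.ker χ)).2 ?_ hp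
  rintro q ⟨hq, hq1⟩
  have := (mem_homogeneousSubmodule 1 q).2 hq1
  rw [homogeneousSubmodule_one_eq_span_X, Submodule.mem_span_range_iff_exists_fun] at this
  obtain ⟨α, rfl⟩ := this
  simp only [smul_eq_C_mul] at hq ⊢
  exact h α ((linear_mem_ker α).1 hq)

/-- The inclusion of `ℂ[x, y, z, w]` in `ℂ[x, y, z, w, a, b, c, d]`. -/
noncomputable def incl : A →ₐ[ℂ] T := aeval ![X 0, X 1, X 2, X 3]

/-- Elimination of `s` through the Euler relation. -/
noncomputable def elim : S →+* T :=
  eval₂Hom incl.toRingHom ![euler (C 5⁻¹) X, X 4, X 5, X 6, X 7]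

theorem elim_C (r : A) : elim (C r) = incl r := by simp [elim]

theorem chart_euler : chart (euler (C 5⁻¹) X) = X 1 * (X 0 * (X 0 + 1)) * X 6 := by
  have h : (5 : P) * C 5⁻¹ = 1 := by
    rw [show (5 : P) = C 5 from (map_ofNat C 5).symm, ← C_mul]; simp
  simp [euler, chart, algebraMap_eq]
  linear_combination (X 1 * (X 0 * (X 0 + 1)) * X 6) * h

theorem chart_fiveLines : chart (elim (C fiveLines)) =
    X 1 ^ 5 * (X 0 * (X 0 + 1)) * X 2 * X 3 := by
  rw [elim_C]
  simp [fiveLines, incl, chart]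
  ring

theorem regular_chart_fiveLines : RegularModK (chart (elim (C fiveLines))) := by
  rw [chart_fiveLines]
  exact (((regular_y.pow 5).mul (regular_u.mul regular_u_add_one)).mul regular_Z).mul regular_W

theorem chart_relation_mem_K (j : Fin 4) :
    chart (elim (C fiveLines * X j.succ)) - chart (elim (C (pderiv j fiveLines) * X 0)) ∈ K := by
  rw [mem_K]
  fin_cases j
  · refine ⟨X 1 ^ 5 * (X 0 * (X 0 + 1)) * X 3, X 1 ^ 5 * (X 0 * (X 0 + 1)) * X 2, ?_⟩
    rw [map_mul, map_mul, map_mul, map_mul, chart_fiveLines, elim_C]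
    simp [pderiv_zero, elim, incl, chart_euler]
    simp [chart]
    ring
  · refine ⟨-(X 0 * X 1 ^ 5 * (X 0 * (X 0 + 1)) * X 3),
      -(X 0 * X 1 ^ 5 * (X 0 * (X 0 + 1)) * X 2), ?_⟩
    rw [map_mul, map_mul, map_mul, map_mul, chart_fiveLines, elim_C]
    simp [pderiv_one, elim, incl, chart_euler]
    simp [chart]
    ring
  · refine ⟨X 1 ^ 6 * (X 0 * (X 0 + 1)) * X 3, 0, ?_⟩
    rw [map_mul, map_mul, map_mul, map_mul, chart_fiveLines, elim_C]
    simp [pderiv_two, elim, incl, chart_euler]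
    simp [chart]
    ring
  · refine ⟨0, X 1 ^ 6 * (X 0 * (X 0 + 1)) * X 2, ?_⟩
    rw [map_mul, map_mul, map_mul, map_mul, chart_fiveLines, elim_C]
    simp [pderiv_three, elim, incl, chart_euler]
    simp [chart]
    ring

theorem elim_mem_J {p : S}
    (hp : p ∈ RingHom.ker (reesPhi fiveLines fun j => pderiv j fiveLines)) : elim p ∈ J := by
  apply mem_J_of_chart_mem
  let χ : S →+* Localization.Away (Ideal.Quotient.mk K (chart (elim (C fiveLines)))) :=
    (algebraMap (P ⧸ K) _).comp ((Ideal.Quotient.mk K).comp (chart.toRingHom.comp elim))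
  have h : χ p = 0 := by
    refine eq_zero_of_mem_ker_reesPhi χ (IsLocalization.Away.mul_invSelf
      (Ideal.Quotient.mk K (chart (elim (C fiveLines))))) (fun j => ?_) hp
    exact congrArg (algebraMap (P ⧸ K) _) (Ideal.Quotient.eq.2 (chart_relation_mem_K j))
  obtain ⟨n, hn⟩ := exists_pow_mul_mem h
  exact regular_chart_fiveLines.pow n _ hn

local notation "L" => kerOne fiveLines fun j => pderiv j fiveLines

/-- The section of `elim` over `ℂ[x, y, z, w, ξ_1, …, ξ_4]`. -/
noncomputable def lift : T →ₐ[ℂ] S :=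
  aeval ![C (X 0), C (X 1), C (X 2), C (X 3), X 1, X 2, X 3, X 4]

theorem euler_mem : C (X 0) * X 1 + C (X 1) * X 2 - 5 * X 0 ∈ L := by
  have : ∑ i, C ((![-5, X 0, X 1, 0, 0] : Fin 5 → A) i) * X i ∈ L := by
    apply linear_mem_kerOne
    simp [Fin.sum_univ_succ]
    rw [pderiv_zero, pderiv_one, fiveLines]
    ring
  convert this using 1
  simp [Fin.sum_univ_succ, map_ofNat]
  ring

theorem minor_zero_mem : C (X 0 * (X 0 + X 1)) * X 1 - C (4 * X 0 + X 1) * X 0 -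
    C (X 0 * (1 - X 2)) * X 3 - C (X 0 * (1 - X 3)) * X 4 ∈ L := by
  have : ∑ i, C ((![-(4 * X 0 + X 1), X 0 * (X 0 + X 1), 0, -(X 0 * (1 - X 2)), -(X 0 * (1 - X 3))]
      : Fin 5 → A) i) * X i ∈ L := by
    apply linear_mem_kerOne
    simp [Fin.sum_univ_succ]
    rw [pderiv_zero, pderiv_two, pderiv_three, fiveLines]
    ring
  convert this using 1
  simp [Fin.sum_univ_succ, map_ofNat]
  ring

theorem minor_one_mem : C (X 0 + X 1 * X 2) * X 3 - C (X 1) * X 0 ∈ L := by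
  have : ∑ i, C ((![-X 1, 0, 0, X 0 + X 1 * X 2, 0] : Fin 5 → A) i) * X i ∈ L := by
    apply linear_mem_kerOne
    simp [Fin.sum_univ_succ]
    rw [pderiv_two, fiveLines]
    ring
  convert this using 1
  simp [Fin.sum_univ_succ]
  ring

theorem minor_two_mem : C (X 0 + X 1 * X 3) * X 4 - C (X 1) * X 0 ∈ L := by
  have : ∑ i, C ((![-X 1, 0, 0, 0, X 0 + X 1 * X 3] : Fin 5 → A) i) * X i ∈ L := by
    apply linear_mem_kerOne
    simp [Fin.sum_univ_succ]
    rw [pderiv_three, fiveLines]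
    ring
  convert this using 1
  simp [Fin.sum_univ_succ]
  ring

theorem euler_mul_minor_eq_zero {N : Type*} [CommRing N] {k : N} {v : Fin 8 → N}
    (h₀ : minor k v 0 = 0) (h₁ : minor k v 1 = 0) (h₂ : minor k v 2 = 0) (i : Fin 6) :
    euler k v * minor k v i = 0 := by
  obtain ⟨e, he⟩ : ∃ e, e = polar k v := ⟨_, rfl⟩
  obtain ⟨s, hs⟩ : ∃ s, s = euler k v := ⟨_, rfl⟩
  simp only [minor, Matrix.cons_val, ← hs, ← he] at h₀ h₁ h₂
  have hs' : s = k * (v 0 * v 4 + v 1 * v 5) := hs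
  fin_cases i <;> simp only [minor, Matrix.cons_val, ← hs, ← he, Fin.reduceFinMk, Fin.zero_eta,
    Fin.mk_one, Fin.isValue]
  · rw [h₀, mul_zero]
  · rw [h₁, mul_zero]
  · rw [h₂, mul_zero]
  · linear_combination (s * v 6 - e * (s - v 2 * v 6)) * hs' +
      k * v 4 * (s * h₁ - (s - v 2 * v 6) * h₀) + k * v 5 * (e * h₁ - v 6 * h₀)
  · linear_combination (s * v 7 - e * (s - v 3 * v 7)) * hs' +
      k * v 4 * (s * h₂ - (s - v 3 * v 7) * h₀) + k * v 5 * (e * h₂ - v 7 * h₀)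
  · linear_combination ((s - v 2 * v 6) * v 7 - v 6 * (s - v 3 * v 7)) * hs' +
      k * v 4 * ((s - v 2 * v 6) * h₂ - (s - v 3 * v 7) * h₁) + k * v 5 * (v 6 * h₂ - v 7 * h₁)

theorem mk_lift_euler : Ideal.Quotient.mk L (lift (euler (C 5⁻¹) X)) =
    Ideal.Quotient.mk L (X 0) := by
  have h5 : (5 : S) * lift (C 5⁻¹) = 1 := by
    rw [← map_ofNat lift 5, ← map_mul, five_mul, map_one]
  rw [Ideal.Quotient.eq]
  have : lift (euler (C 5⁻¹) X) - X 0 =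
      lift (C 5⁻¹) * (C (X 0) * X 1 + C (X 1) * X 2 - 5 * X 0) := by
    have hX : ∀ j, lift (X j) = _ := aeval_X _
    simp only [euler, map_mul, map_add, hX, Matrix.cons_val]
    linear_combination X 0 * h5
  rw [this]
  exact Ideal.mul_mem_left _ _ euler_mem

theorem mk_lift_elim (p : S) : Ideal.Quotient.mk L (lift (elim p)) = Ideal.Quotient.mk L p := by
  have : (Ideal.Quotient.mk L).comp (lift.toRingHom.comp elim) = Ideal.Quotient.mk L := by
    refine ringHom_ext (fun r => ?_) fun j => ?_
    · change Ideal.Quotient.mk L (lift (elim (C r))) = Ideal.Quotient.mk L (C r)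
      rw [elim_C]
      congr 1
      have : lift.comp incl = IsScalarTower.toAlgHom ℂ A S := by
        ext i
        fin_cases i <;> simp [lift, incl, algebraMap_eq]
      exact DFunLike.congr_fun this r
    · change Ideal.Quotient.mk L (lift (elim (X j))) = Ideal.Quotient.mk L (X j)
      fin_cases j
      · simpa [elim] using mk_lift_euler
      all_goals simp [elim, lift]
  exact DFunLike.congr_fun this p

theorem X_mul_lift_mem {q : T} (hq : q ∈ J) : X 0 * lift q ∈ L := by
  obtain ⟨Q, rfl⟩ := Ideal.mem_span_range_iff_exists_fun.1 hq
  let F : T →+* S ⧸ L := (Ideal.Quotient.mk L).comp lift.toRingHom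
  have hF : ∀ i, F (m i) = minor (F (C 5⁻¹)) (fun j => F (X j)) i := map_minor _ _ _
  have hs : euler (F (C 5⁻¹)) (fun j => F (X j)) = Ideal.Quotient.mk L (X 0) := by
    rw [← mk_lift_euler]
    simp [euler, F]
  have h := euler_mul_minor_eq_zero (k := F (C 5⁻¹)) (v := fun j => F (X j)) ?_ ?_ ?_
  · rw [← Ideal.Quotient.eq_zero_iff_mem, map_mul]
    change _ * F _ = 0
    rw [map_sum, Finset.mul_sum]
    refine Finset.sum_eq_zero fun i _ => ?_
    rw [map_mul, mul_left_comm, hF, ← hs, h, mul_zero]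
  · simp only [minor, Matrix.cons_val, polar, hs]
    rw [← Ideal.Quotient.eq_zero_iff_mem.2 minor_zero_mem]
    simp [F, lift, map_ofNat]
    ring
  · simp only [minor, Matrix.cons_val, hs]
    rw [← Ideal.Quotient.eq_zero_iff_mem.2 minor_one_mem]
    simp [F, lift]
    ring
  · simp only [minor, Matrix.cons_val, hs]
    rw [← Ideal.Quotient.eq_zero_iff_mem.2 minor_two_mem]
    simp [F, lift]
    ring

theorem X_mul_mem {p : S}
    (hp : p ∈ RingHom.ker (reesPhi fiveLines fun j => pderiv j fiveLines)) : X 0 * p ∈ L := by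
  have h := X_mul_lift_mem (elim_mem_J hp)
  rwa [← Ideal.Quotient.eq_zero_iff_mem, map_mul, mk_lift_elim, ← map_mul,
    Ideal.Quotient.eq_zero_iff_mem] at h

theorem A_X_ne (i : Fin 4) : (X i : A) ≠ 0 := X_ne_zero i

theorem ne_zero_of_eval {p : A} (v : Fin 4 → ℂ) (h : eval v p ≠ 0) : p ≠ 0 := fun h0 => by
  simp [h0] at h

local notation "pt" => (eval ![0, 0, 0, 1] : A →+* ℂ)

/-- Logarithmic derivations along the five lines: the coefficients of `∂/∂z` and `∂/∂w` cancel
at the point `(0, 0, 0, 1)`. -/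
theorem coeff_add_eq_zero {α : Fin 5 → A}
    (h : α 0 * fiveLines + ∑ j : Fin 4, α j.succ * pderiv j fiveLines = 0) :
    pt (α 3 + α 4) = 0 := by
  simp only [Fin.sum_univ_four, pderiv_zero, pderiv_one, pderiv_two, pderiv_three,
    Fin.reduceSucc] at h
  rw [fiveLines] at h
  generalize α 0 = B₀, α 1 = B₁, α 2 = B₂, α 3 = B₃, α 4 = B₄ at h ⊢
  obtain ⟨C₁, rfl⟩ : X 0 ∣ B₁ := by
    refine dvd_of_bind₁_eq_zero (g := ![0, X 1, X 2, X 3]) (fun i => by fin_cases i <;> simp) ?_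
    have h0 := congrArg (bind₁ (![0, X 1, X 2, X 3] : Fin 4 → A)) h
    simpa [A_X_ne] using h0
  obtain ⟨C₂, rfl⟩ : X 1 ∣ B₂ := by
    refine dvd_of_bind₁_eq_zero (g := ![X 0, 0, X 2, X 3]) (fun i => by fin_cases i <;> simp) ?_
    have h0 := congrArg (bind₁ (![X 0, 0, X 2, X 3] : Fin 4 → A)) h
    simpa [A_X_ne] using h0
  have h₁ : X 0 + X 1 ∣ C₁ - C₂ := by
    refine dvd_of_bind₁_eq_zero (g := ![-X 1, X 1, X 2, X 3])
      (fun i => by fin_cases i <;> simp) ?_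
    have h0 := congrArg (bind₁ (![-X 1, X 1, X 2, X 3] : Fin 4 → A)) h
    simp [-mul_eq_zero] at h0
    have hne : X 1 ^ 5 * ((X 2 - 1) * (X 3 - 1)) ≠ (0 : A) :=
      ne_zero_of_eval ![0, 1, 0, 0] (by simp)
    apply mul_left_cancel₀ hne
    rw [map_sub]
    linear_combination h0
  have h₂ : X 0 + X 1 * X 2 ∣ B₃ - X 2 * (C₁ - C₂) := by
    refine dvd_of_bind₁_eq_zero (g := ![-(X 1 * X 2), X 1, X 2, X 3])
      (fun i => by fin_cases i <;> simp) ?_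
    have h0 := congrArg (bind₁ (![-(X 1 * X 2), X 1, X 2, X 3] : Fin 4 → A)) h
    simp [-mul_eq_zero] at h0
    have hne : X 1 ^ 5 * X 2 * ((1 - X 2) * (X 3 - X 2)) ≠ (0 : A) :=
      ne_zero_of_eval ![0, 1, 2, 0] (by simp; norm_num)
    apply mul_left_cancel₀ hne
    simp [-mul_eq_zero]
    linear_combination -h0
  have h₃ : X 0 + X 1 * X 3 ∣ B₄ - X 3 * (C₁ - C₂) := by
    refine dvd_of_bind₁_eq_zero (g := ![-(X 1 * X 3), X 1, X 2, X 3])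
      (fun i => by fin_cases i <;> simp) ?_
    have h0 := congrArg (bind₁ (![-(X 1 * X 3), X 1, X 2, X 3] : Fin 4 → A)) h
    simp [-mul_eq_zero] at h0
    have hne : X 1 ^ 5 * X 3 * ((1 - X 3) * (X 2 - X 3)) ≠ (0 : A) :=
      ne_zero_of_eval ![0, 1, 0, 2] (by simp; norm_num)
    apply mul_left_cancel₀ hne
    simp [-mul_eq_zero]
    linear_combination -h0
  replace h₁ := map_dvd pt h₁
  replace h₂ := map_dvd pt h₂
  replace h₃ := map_dvd pt h₃
  simp at h₁ h₂ h₃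
  rw [map_add]
  linear_combination h₂ + h₃ + h₁

/-- Evaluation at `(x, y, z, w) = (0, 0, 0, 1)`, `(s, ξ_1, ξ_2, ξ_3, ξ_4) = (0, 0, 0, 1, 1)`. -/
noncomputable def evalPoint : S →+* ℂ := eval₂Hom pt ![0, 0, 0, 1, 1]

theorem evalPoint_eq_zero {p : S} (hp : p ∈ L) : evalPoint p = 0 := by
  refine map_kerOne_eq_zero evalPoint (fun α h => ?_) hp
  have := coeff_add_eq_zero h
  rw [map_add] at this
  simpa [evalPoint, Fin.sum_univ_succ] using this

theorem ker_ne_kerOne : RingHom.ker (reesPhi fiveLines fun j => pderiv j fiveLines) ≠ L := by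
  intro h
  have hQ : C (X 3 - X 2) * X 3 * X 4 - X 0 * (X 3 - X 4) ∈
      RingHom.ker (reesPhi fiveLines fun j => pderiv j fiveLines) := by
    have h₀ : reesPhi fiveLines (fun j => pderiv j fiveLines) (X 0) = _ := aeval_X _ _
    have h₃ : reesPhi fiveLines (fun j => pderiv j fiveLines) (X 3) = _ := aeval_X _ (Fin.succ 2)
    have h₄ : reesPhi fiveLines (fun j => pderiv j fiveLines) (X 4) = _ := aeval_X _ (Fin.succ 3)
    have hC : ∀ r, reesPhi fiveLines (fun j => pderiv j fiveLines) (C r) = Polynomial.C r :=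
      fun r => aeval_C _ _
    rw [RingHom.mem_ker]
    simp only [map_sub, map_mul, h₀, h₃, h₄, hC, Fin.cons_zero, Fin.cons_succ]
    rw [pderiv_two, pderiv_three, fiveLines]
    simp only [map_mul, map_add, map_pow]
    ring
  rw [h] at hQ
  simpa [evalPoint] using evalPoint_eq_zero hQ

end FiveLines

/-- For the "five lines" divisor, with `g_j = ∂f/∂x_j`, one has
`s·p ∈ ker^{(1)}φ` for every `p ∈ ker φ`, while `ker φ ≠ ker^{(1)}φ`: property (GCL)
holds with `N = 1` but the divisor is not of commutative linear type. -/
theorem fiveLines_GCL_not_linear_type :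
    (∀ p ∈ RingHom.ker (reesPhi fiveLines fun j => pderiv j fiveLines),
      (X 0 : MvPolynomial (Fin 5) (MvPolynomial (Fin 4) ℂ)) * p ∈
        kerOne fiveLines fun j => pderiv j fiveLines) ∧
    RingHom.ker (reesPhi fiveLines fun j => pderiv j fiveLines) ≠
      kerOne fiveLines fun j => pderiv j fiveLines := by
  exact ⟨fun _ hp => FiveLines.X_mul_mem hp, FiveLines.ker_ne_kerOne⟩
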